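/- Let k be a field, let n ≥ 1 and 0 ≤ p < n, and let I ⊆ k[x_0, x_1, ..., x_n] be the ideal generated by the products Q_σ = ∏_{i ∈ σ} (x_i^2 − x_0^2), where σ ranges over all subsets of {1, ..., n} of cardinality p+1. Let ≼ be a monomial order on the monomials of k[x_0, x_1, ..., x_n] in which x_0 is the least variable, i.e. x_0 ≺ x_i for all 1 ≤ i ≤ n. Then for every nonzero f ∈ I there exists a subset σ ⊆ {1, ..., n} with |σ| = p+1 such that the monomial ∏_{i ∈ σ} x_i^2 divides the leading monomial of f with respect to ≼; equivalently, the set {Q_σ : |σ| = p+1} is a Gröbner basis of I with respect to any such monomial order. -/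

import Mathlib

open MvPolynomial

section SquareReduction

variable {ι : Type*}

/-- The largest part of the exponent `e` supported on `S` all of whose entries are even. -/
noncomputable def evenPart (S : Finset ι) (e : ι →₀ ℕ) : ι →₀ ℕ :=
  ∑ i ∈ S, Finsupp.single i (2 * (e i / 2))

/-- The exponent obtained from `e` by replacing `x_i ^ 2` by `x_z ^ 2` as often as possible,
for every `i ∈ S`. -/
noncomputable def reduceSquares (S : Finset ι) (z : ι) (e : ι →₀ ℕ) : ι →₀ ℕ :=
  e - evenPart S e + Finsupp.single z (∑ i ∈ S, 2 * (e i / 2))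

theorem evenPart_apply [DecidableEq ι] (S : Finset ι) (e : ι →₀ ℕ) (j : ι) :
    evenPart S e j = if j ∈ S then 2 * (e j / 2) else 0 := by
  simp [evenPart, Finsupp.finsetSum_apply, Finsupp.single_apply]

theorem evenPart_le (S : Finset ι) (e : ι →₀ ℕ) : evenPart S e ≤ e := by
  classical
  intro j
  rw [evenPart_apply]
  split_ifs <;> omega

theorem reduceSquares_eq_self {S : Finset ι} {e : ι →₀ ℕ} (z : ι) (he : ∀ i ∈ S, e i < 2) :
    reduceSquares S z e = e := by
  have h : ∀ i ∈ S, 2 * (e i / 2) = 0 := fun i hi ↦ by have := he i hi; omega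
  rw [reduceSquares, evenPart, Finset.sum_eq_zero h,
    Finset.sum_eq_zero fun i hi ↦ by rw [h i hi, Finsupp.single_zero]]
  simp

theorem reduceSquares_add_single {S : Finset ι} {z i : ι} (hz : z ∉ S) (hi : i ∈ S)
    (e : ι →₀ ℕ) :
    reduceSquares S z (e + Finsupp.single i 2) = reduceSquares S z (e + Finsupp.single z 2) := by
  classical
  have h₁ : ∑ j ∈ S, 2 * ((e + Finsupp.single i 2 : ι →₀ ℕ) j / 2) =
      ∑ j ∈ S, 2 * (e j / 2) + 2 := by
    rw [← Finset.add_sum_erase S _ hi, ← Finset.add_sum_erase S (fun j ↦ 2 * (e j / 2)) hi,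
      Finset.sum_congr rfl (g := fun j ↦ 2 * (e j / 2))]
    · simp only [Finsupp.add_apply, Finsupp.single_eq_same]
      omega
    · intro j hj
      simp [Finsupp.single_eq_of_ne (Finset.ne_of_mem_erase hj)]
  have h₂ : ∑ j ∈ S, 2 * ((e + Finsupp.single z 2 : ι →₀ ℕ) j / 2) = ∑ j ∈ S, 2 * (e j / 2) := by
    refine Finset.sum_congr rfl fun j hj ↦ ?_
    have : j ≠ z := fun h ↦ hz (h ▸ hj)
    simp [Finsupp.single_eq_of_ne this]
  rw [reduceSquares, reduceSquares, h₁, h₂]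
  ext j
  simp only [Finsupp.add_apply, Finsupp.tsub_apply, evenPart_apply, Finsupp.single_apply]
  grind

theorem toSyn_reduceSquares_le (m : MonomialOrder ι) {S : Finset ι} {z : ι}
    (hS : ∀ i ∈ S, m.toSyn (Finsupp.single z 1) ≤ m.toSyn (Finsupp.single i 1)) (e : ι →₀ ℕ) :
    m.toSyn (reduceSquares S z e) ≤ m.toSyn e := by
  have h : m.toSyn (Finsupp.single z (∑ i ∈ S, 2 * (e i / 2))) ≤ m.toSyn (evenPart S e) := by
    rw [evenPart, Finsupp.single_finsetSum, map_sum, map_sum]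
    refine Finset.sum_le_sum fun i hi ↦ ?_
    rw [← mul_one (2 * (e i / 2)), ← smul_eq_mul, ← Finsupp.smul_single, ← Finsupp.smul_single,
      map_nsmul, map_nsmul]
    exact nsmul_le_nsmul_right (hS i hi) _
  conv_rhs => rw [← tsub_add_cancel_of_le (evenPart_le S e)]
  rw [reduceSquares, map_add, map_add]
  gcongr

/-- If a polynomial lies in the ideal generated by `x_i ^ 2 - x_z ^ 2` for `i ∈ S`, and `x_z` is
at most every `x_i`, then its leading monomial is divisible by some `x_i ^ 2` with `i ∈ S`. -/
theorem exists_two_le_of_mem_span_sq_sub_sq {k : Type*} [CommRing k] (m : MonomialOrder ι)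
    {S : Finset ι} {z : ι} (hz : z ∉ S)
    (hS : ∀ i ∈ S, m.toSyn (Finsupp.single z 1) ≤ m.toSyn (Finsupp.single i 1))
    {f : MvPolynomial ι k}
    (hf : f ∈ Ideal.span ((fun i ↦ (X i ^ 2 - X z ^ 2 : MvPolynomial ι k)) '' S))
    {d : ι →₀ ℕ} (hd : d ∈ f.support) (hmax : ∀ e ∈ f.support, m.toSyn e ≤ m.toSyn d) :
    ∃ i ∈ S, 2 ≤ d i := by
  classical
  by_contra! hlt
  let N : MvPolynomial ι k →ₗ[k] k :=
    (basisMonomials ι k).constr k fun e ↦ if reduceSquares S z e = d then 1 else 0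
  have hN (e : ι →₀ ℕ) (a : k) :
      N (monomial e a) = if reduceSquares S z e = d then a else 0 := by
    have h := (basisMonomials ι k).constr_basis k
      (fun e ↦ if reduceSquares S z e = d then (1 : k) else 0) e
    rw [coe_basisMonomials] at h
    rw [← mul_one a, ← smul_eq_mul, ← smul_monomial, map_smul]
    simp [N, h]
  have hgen (i : ι) (hi : i ∈ S) (g : MvPolynomial ι k) : N (g * (X i ^ 2 - X z ^ 2)) = 0 := by
    induction g using MvPolynomial.induction_on' with
    | monomial e a =>
      rw [mul_sub, X_pow_eq_monomial, X_pow_eq_monomial, monomial_mul, monomial_mul, map_sub, hN,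
        hN, reduceSquares_add_single hz hi, sub_self]
    | add p q hp hq => rw [add_mul, map_add, hp, hq, add_zero]
  have hzero : N f = 0 := by
    refine Submodule.span_induction (p := fun f _ ↦ ∀ g, N (g * f) = 0) ?_ (by simp) ?_ ?_ hf 1
      |> fun h ↦ by simpa using h
    · rintro _ ⟨i, hi, rfl⟩ g
      exact hgen i hi g
    · intro p q _ _ hp hq g
      rw [mul_add, map_add, hp, hq, add_zero]
    · intro a p _ hp g
      rw [smul_eq_mul, ← mul_assoc, hp]
  have hcoeff : N f = coeff d f := by
    conv_lhs => rw [f.as_sum]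
    rw [map_sum, Finset.sum_eq_single d]
    · rw [hN, if_pos (reduceSquares_eq_self z hlt)]
    · intro e he hne
      rw [hN, if_neg]
      rintro rfl
      exact hne (m.toSyn.injective ((hmax e he).antisymm (toSyn_reduceSquares_le m hS e)))
    · exact fun h ↦ absurd hd h
  exact mem_support_iff.mp hd (hcoeff ▸ hzero)

end SquareReduction

/-- Let `I ⊆ k[x_0,…,x_n]` be the ideal generated by the products
`Q_σ = ∏_{i ∈ σ} (x_i^2 - x_0^2)` over subsets `σ ⊆ {1,…,n}` of cardinality `p+1`, and
let `m` be a monomial order in which `x_0` is the least variable.  Then for every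
nonzero `f ∈ I`, the leading monomial of `f` (the `m`-largest exponent `d` in the
support of `f`) is divisible by some monomial `∏_{i ∈ σ} x_i^2` with `σ ⊆ {1,…,n}` of
cardinality `p+1`, i.e. the `Q_σ` form a Gröbner basis of `I` for `m`. -/
theorem skeleton_groebner_basis (k : Type*) [Field k] (n p : ℕ) (hn : 1 ≤ n)
    (hpn : p < n) (m : MonomialOrder (Fin (n + 1)))
    (hx0 : ∀ i : Fin (n + 1), i ≠ 0 →
      m.toSyn (Finsupp.single 0 1) < m.toSyn (Finsupp.single i 1)) :
    ∀ f ∈ Ideal.span {g : MvPolynomial (Fin (n + 1)) k |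
        ∃ σ : Finset (Fin (n + 1)), 0 ∉ σ ∧ σ.card = p + 1 ∧
          g = ∏ i ∈ σ, (X i ^ 2 - X 0 ^ 2)},
      f ≠ 0 →
        ∀ d ∈ f.support, (∀ e ∈ f.support, m.toSyn e ≤ m.toSyn d) →
          ∃ σ : Finset (Fin (n + 1)), 0 ∉ σ ∧ σ.card = p + 1 ∧ ∀ i ∈ σ, 2 ≤ d i := by
  classical
  intro f hf _ d hd hmax
  by_contra! hσ
  let T : Finset (Fin (n + 1)) := {i | i ≠ 0 ∧ 2 ≤ d i}
  let S : Finset (Fin (n + 1)) := {i | i ≠ 0 ∧ d i < 2}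
  have hT : T.card < p + 1 := by
    by_contra! hcard
    obtain ⟨σ, hσT, hcard⟩ := Finset.exists_subset_card_eq hcard
    obtain ⟨i, hi, hlt⟩ := hσ σ (fun h ↦ by simpa [T] using hσT h) hcard
    have := hσT hi
    simp only [T, Finset.mem_filter] at this
    omega
  have hle : Ideal.span {g : MvPolynomial (Fin (n + 1)) k |
        ∃ σ : Finset (Fin (n + 1)), 0 ∉ σ ∧ σ.card = p + 1 ∧
          g = ∏ i ∈ σ, (X i ^ 2 - X 0 ^ 2)} ≤
      Ideal.span ((fun i ↦ (X i ^ 2 - X 0 ^ 2 : MvPolynomial (Fin (n + 1)) k)) '' S) := by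
    rw [Ideal.span_le]
    rintro _ ⟨σ, h0, hcard, rfl⟩
    obtain ⟨i, hi, hiT⟩ := Finset.exists_mem_notMem_of_card_lt_card (hT.trans_eq hcard.symm)
    have hi0 : i ≠ 0 := fun h ↦ h0 (h ▸ hi)
    have hiS : i ∈ S := by
      simp only [T, S, Finset.mem_filter, Finset.mem_univ, true_and, not_and, not_le] at hiT ⊢
      exact ⟨hi0, hiT hi0⟩
    exact Ideal.mem_of_dvd _ (Finset.dvd_prod_of_mem _ hi)
      (Ideal.subset_span (Set.mem_image_of_mem _ hiS))
  obtain ⟨i, hi, h2⟩ := exists_two_le_of_mem_span_sq_sub_sq m (z := 0) (by simp [S])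
    (fun i hi ↦ (hx0 i (by simp only [S, Finset.mem_filter] at hi; exact hi.2.1)).le)
    (hle hf) hd hmax
  simp only [S, Finset.mem_filter] at hi
  omega
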